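/- Let G be a group (finite or infinite) with |G/Z(G)| = p³ for a prime p. Then |Cent(G)| = p² + p + 2 or p² + 2. Moreover, the first case occurs exactly when G has no centralizer of index p, and the second when it has a centralizer of index p. -/

import Mathlib

def Cent (G : Type*) [Group G] : Set (Subgroup G) :=
  {H | ∃ x : G, H = Subgroup.centralizer {x}}

open Subgroup in
theorem exists_index_eq_pow_of_center_le {G : Type*} [Group G] {p n : ℕ} (hp : p.Prime)
    (h : (center G).index = p ^ n) {H : Subgroup G} (hH : center G ≤ H) :
    ∃ k, H.index = p ^ k := by
  obtain ⟨k, -, hk⟩ := (Nat.dvd_prime_pow hp).1 (h ▸ index_dvd_of_le hH)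
  exact ⟨k, hk⟩

open Subgroup in
theorem exponent_lt_of_lt {G : Type*} [Group G] {p a b : ℕ} (hp : p.Prime)
    {H K : Subgroup G} (hHK : H < K) (hH : H.index = p ^ b) (hK : K.index = p ^ a) :
    a < b := by
  have : H.FiniteIndex := ⟨by rw [hH]; exact pow_ne_zero _ hp.ne_zero⟩
  have hlt := index_strictAnti hHK
  rw [hH, hK] at hlt
  exact (Nat.pow_lt_pow_iff_right hp.one_lt).1 hlt

open Subgroup in
theorem commute_of_mem_centralizer {G : Type*} [Group G] {p : ℕ} (hp : p.Prime)
    (h : (center G).index = p ^ 3) {x y z : G} (hx : x ∉ center G)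
    (hy : y ∈ centralizer ({x} : Set G)) (hz : z ∈ centralizer ({x} : Set G)) :
    y * z = z * y := by
  by_contra hyz
  rw [mem_centralizer_singleton_iff] at hy hz
  set A := centralizer ({x} : Set G) with hA
  set B := A ⊓ centralizer ({y} : Set G) with hB
  set C := B ⊓ centralizer ({z} : Set G) with hC
  have hZ (w : G) : center G ≤ centralizer ({w} : Set G) := center_le_centralizer _
  have hZB : center G ≤ B := le_inf (hZ x) (hZ y)
  have hZC : center G ≤ C := le_inf hZB (hZ z)
  have h1 : center G < C := lt_of_le_of_ne hZC fun he => hx <| by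
    rw [he]
    simp only [hC, hB, hA, mem_inf, mem_centralizer_singleton_iff]
    exact ⟨⟨trivial, hy.symm⟩, hz.symm⟩
  have h2 : C < B := lt_of_le_of_ne inf_le_left fun he => by
    have : y ∈ C := by
      rw [he]
      simp only [hB, hA, mem_inf, mem_centralizer_singleton_iff]
      exact ⟨hy, trivial⟩
    exact hyz (mem_centralizer_singleton_iff.1 this.2)
  have h3 : B < A := lt_of_le_of_ne inf_le_left fun he => by
    have : z ∈ B := by
      rw [he]
      exact mem_centralizer_singleton_iff.2 hz
    exact hyz (mem_centralizer_singleton_iff.1 this.2).symm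
  have h4 : A < ⊤ := lt_top_iff_ne_top.2 fun he => hx <| by
    rw [mem_center_iff]
    intro g
    exact mem_centralizer_singleton_iff.1 (he ▸ mem_top g : g ∈ A)
  obtain ⟨c, hc⟩ := exists_index_eq_pow_of_center_le hp h hZC
  obtain ⟨b, hb⟩ := exists_index_eq_pow_of_center_le hp h hZB
  obtain ⟨a, ha⟩ := exists_index_eq_pow_of_center_le hp h (hZ x)
  have e1 := exponent_lt_of_lt hp h1 h hc
  have e2 := exponent_lt_of_lt hp h2 hc hb
  have e3 := exponent_lt_of_lt hp h3 hb ha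
  have e4 := exponent_lt_of_lt hp h4 ha (a := 0) (by simp)
  omega

open Subgroup in
theorem centralizer_eq_top_iff_mem_center {G : Type*} [Group G] {x : G} :
    centralizer ({x} : Set G) = ⊤ ↔ x ∈ center G := by
  simp [centralizer_eq_top_iff_subset]

open Subgroup in
theorem centralizer_eq_centralizer_iff {G : Type*} [Group G] {p : ℕ} (hp : p.Prime)
    (h : (center G).index = p ^ 3) {x y : G} (hx : x ∉ center G) :
    centralizer ({y} : Set G) = centralizer ({x} : Set G) ↔
      y ∈ centralizer ({x} : Set G) ∧ y ∉ center G := by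
  refine ⟨fun he => ⟨he ▸ mem_centralizer_singleton_iff.2 rfl, fun hy => hx ?_⟩,
    fun ⟨hy, hyc⟩ => le_antisymm (fun z hz => ?_) fun z hz => ?_⟩
  · rwa [← centralizer_eq_top_iff_mem_center, ← he, centralizer_eq_top_iff_mem_center]
  · exact mem_centralizer_singleton_iff.2 <| commute_of_mem_centralizer hp h hyc hz <|
      mem_centralizer_singleton_iff.2 (mem_centralizer_singleton_iff.1 hy).symm
  · exact mem_centralizer_singleton_iff.2 (commute_of_mem_centralizer hp h hx hz hy)

open Subgroup in
theorem centralizer_quotient_out {G : Type*} [Group G] (x : G) :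
    centralizer ({(x : G ⧸ center G).out} : Set G) = centralizer ({x} : Set G) := by
  obtain ⟨⟨c, hc⟩, he⟩ := QuotientGroup.mk_out_eq_mul (center G) x
  rw [he]
  ext g
  have hg := mem_center_iff.1 hc g
  simp only [mem_centralizer_singleton_iff]
  rw [← mul_assoc, mul_assoc x c g, ← hg, ← mul_assoc, mul_left_inj]

open Subgroup in
/-- Counts the classes modulo the center whose representatives have the same centralizer as `x`. -/
theorem card_fiber_centralizer {G : Type*} [Group G] [Fintype (G ⧸ center G)]
    [DecidableEq (Subgroup G)] {p : ℕ} (hp : p.Prime)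
    (h : (center G).index = p ^ 3) {x : G} (hx : x ∉ center G) :
    ((Finset.univ.filter fun q : G ⧸ center G =>
      centralizer ({q.out} : Set G) = centralizer ({x} : Set G)).card + 1) *
        (centralizer ({x} : Set G)).index = p ^ 3 := by
  classical
  set H := centralizer ({x} : Set G) with hH
  have hZ : center G ≤ H := center_le_centralizer _
  have hmem (q : G ⧸ center G) : q ∈ H.map (QuotientGroup.mk' (center G)) ↔ q.out ∈ H := by
    conv_rhs => rw [← comap_map_eq_self (f := QuotientGroup.mk' (center G)) (H := H)
      (by simpa using hZ), mem_comap, QuotientGroup.mk'_apply, QuotientGroup.out_eq']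
  have hone (q : G ⧸ center G) : q.out ∈ center G ↔ q = 1 := by
    rw [← QuotientGroup.eq_one_iff, QuotientGroup.out_eq']
  have hf : (Finset.univ.filter fun q : G ⧸ center G => centralizer ({q.out} : Set G) = H) =
      (Finset.univ.filter fun q => q ∈ H.map (QuotientGroup.mk' (center G))).erase 1 := by
    ext q
    simp only [Finset.mem_filter, Finset.mem_univ, true_and, Finset.mem_erase, hmem]
    rw [centralizer_eq_centralizer_iff hp h hx, hone, and_comm]
  have hi : (H.map (QuotientGroup.mk' (center G))).index = H.index :=
    index_map_eq _ (QuotientGroup.mk'_surjective _) (by simpa using hZ)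
  have hmem_one : (1 : G ⧸ center G) ∈
      Finset.univ.filter fun q => q ∈ H.map (QuotientGroup.mk' (center G)) :=
    Finset.mem_filter.2 ⟨Finset.mem_univ _, one_mem _⟩
  rw [hf, Finset.card_erase_add_one hmem_one, ← hi, ← h, (center G).index_eq_card,
    ← (H.map (QuotientGroup.mk' (center G))).card_mul_index]
  congr 1
  rw [Nat.card_eq_fintype_card, Fintype.card_subtype]

theorem card_cent_of_central_quotient_p_cubed
    (G : Type*) [Group G] (p : ℕ) (hp : p.Prime)
    (h : Nat.card (G ⧸ Subgroup.center G) = p ^ 3) :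
    ((¬ ∃ x : G, (Subgroup.centralizer ({x} : Set G)).index = p) →
        (Cent G).ncard = p ^ 2 + p + 2) ∧
    ((∃ x : G, (Subgroup.centralizer ({x} : Set G)).index = p) →
        (Cent G).ncard = p ^ 2 + 2) := by
  classical
  have hfin : Finite (G ⧸ Subgroup.center G) :=
    Nat.finite_of_card_ne_zero (by rw [h]; exact pow_ne_zero _ hp.ne_zero)
  have := Fintype.ofFinite (G ⧸ Subgroup.center G)
  have hc : (Subgroup.center G).index = p ^ 3 := h
  set f : G ⧸ Subgroup.center G → Subgroup G :=
    fun q => Subgroup.centralizer ({q.out} : Set G) with hf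
  set S : Finset (Subgroup G) := Finset.univ.image f with hS
  have hCS : Cent G = S := by
    ext H
    simp only [Cent, Set.mem_ofPred_eq, hS, Finset.coe_image, Finset.coe_univ, Set.image_univ,
      Set.mem_range]
    exact ⟨fun ⟨x, hx⟩ => ⟨x, by rw [hx]; exact centralizer_quotient_out x⟩,
      fun ⟨q, hq⟩ => ⟨q.out, hq.symm⟩⟩
  rw [hCS, Set.ncard_coe_finset]
  have hmemS (x : G) : Subgroup.centralizer ({x} : Set G) ∈ S := by
    rw [← Finset.mem_coe, ← hCS]; exact ⟨x, rfl⟩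
  have hSmem {H : Subgroup G} (hH : H ∈ S) : ∃ x, H = Subgroup.centralizer ({x} : Set G) := by
    rw [← Finset.mem_coe, ← hCS] at hH; exact hH
  have htop : ⊤ ∈ S := by
    rw [← centralizer_eq_top_iff_mem_center.2 (one_mem (Subgroup.center G))]; exact hmemS 1
  set T := S.erase ⊤ with hT
  have hTS : T.card + 1 = S.card := Finset.card_erase_add_one htop
  have hTmem {H : Subgroup G} (hH : H ∈ T) :
      ∃ x ∉ Subgroup.center G, H = Subgroup.centralizer ({x} : Set G) := by
    obtain ⟨hne, hHS⟩ := Finset.mem_erase.1 hH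
    obtain ⟨x, rfl⟩ := hSmem hHS
    exact ⟨x, fun hx => hne (centralizer_eq_top_iff_mem_center.2 hx), rfl⟩
  set F : Subgroup G → ℕ := fun H => (Finset.univ.filter fun q => f q = H).card with hF
  have hFtop : F ⊤ = 1 := by
    rw [hF, Finset.card_eq_one]
    refine ⟨1, ?_⟩
    ext q
    simp only [Finset.mem_filter, Finset.mem_univ, true_and, Finset.mem_singleton, hf]
    rw [centralizer_eq_top_iff_mem_center, ← QuotientGroup.eq_one_iff, QuotientGroup.out_eq']
  have hsum : ∑ H ∈ T, F H + 1 = p ^ 3 := by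
    rw [← hFtop, Finset.sum_erase_add _ _ htop, ← h, Nat.card_eq_fintype_card,
      ← Finset.card_univ]
    exact (Finset.card_eq_sum_card_image f Finset.univ).symm
  have hcount {H : Subgroup G} (hH : H ∈ T) : (F H + 1) * H.index = p ^ 3 := by
    obtain ⟨x, hx, rfl⟩ := hTmem hH
    exact card_fiber_centralizer hp hc hx
  have hindex {H : Subgroup G} (hH : H ∈ T) : H.index = p ∨ H.index = p ^ 2 := by
    obtain ⟨x, hx, rfl⟩ := hTmem hH
    have hle : Subgroup.center G ≤ Subgroup.centralizer ({x} : Set G) :=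
      Subgroup.center_le_centralizer _
    obtain ⟨k, hk⟩ := exists_index_eq_pow_of_center_le hp hc hle
    have h1 := exponent_lt_of_lt hp (lt_of_le_of_ne hle fun he => hx (by
      rw [he, Subgroup.mem_centralizer_singleton_iff])) hc hk
    have h2 := exponent_lt_of_lt hp (lt_top_iff_ne_top.2
      (mt centralizer_eq_top_iff_mem_center.1 hx)) hk (a := 0) (by simp)
    interval_cases k <;> simp_all
  have hp0 := hp.pos
  have hp1 : 0 < p - 1 := Nat.sub_pos_of_lt hp.one_lt
  have hFp2 {H : Subgroup G} (hH : H ∈ T) (hi : H.index = p ^ 2) : F H + 1 = p := by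
    have := hcount hH
    rw [hi] at this
    exact Nat.eq_of_mul_eq_mul_right (pow_pos hp0 2) (this.trans (by ring))
  have hFp {H : Subgroup G} (hH : H ∈ T) (hi : H.index = p) : F H + 1 = p ^ 2 := by
    have := hcount hH
    rw [hi] at this
    exact Nat.eq_of_mul_eq_mul_right hp0 (this.trans (by ring))
  constructor
  · intro hno
    have hconst : ∑ H ∈ T, F H = T.card * (p - 1) := by
      rw [Finset.sum_const_nat]
      intro H hH
      have hne : H.index ≠ p := fun hi => by
        obtain ⟨x, -, rfl⟩ := hTmem hH
        exact hno ⟨x, hi⟩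
      have := hFp2 hH ((hindex hH).resolve_left hne)
      omega
    rw [hconst] at hsum
    obtain ⟨r, rfl⟩ : ∃ r, p = r + 1 := ⟨p - 1, by omega⟩
    rw [Nat.add_sub_cancel] at hsum hp1
    have : T.card = (r + 1) ^ 2 + (r + 1) + 1 :=
      Nat.eq_of_mul_eq_mul_right hp1 (by linarith)
    omega
  · rintro ⟨x, hx⟩
    set A := Subgroup.centralizer ({x} : Set G) with hA
    have hAT : A ∈ T := Finset.mem_erase.2 ⟨fun he => hp.one_lt.ne (by
      rw [← hx, he, Subgroup.index_top]), hmemS x⟩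
    have hxc : x ∉ Subgroup.center G := fun hxc =>
      Finset.ne_of_mem_erase hAT (centralizer_eq_top_iff_mem_center.2 hxc)
    have huniq {H : Subgroup G} (hH : H ∈ T) (hi : H.index = p) : H = A := by
      obtain ⟨y, hy, rfl⟩ := hTmem hH
      by_contra hne
      have hle : Subgroup.centralizer ({y} : Set G) ⊓ A ≤ Subgroup.center G := by
        rintro z ⟨hzy, hzx⟩
        by_contra hz
        exact hne (((centralizer_eq_centralizer_iff hp hc hy).2 ⟨hzy, hz⟩).symm.trans
          ((centralizer_eq_centralizer_iff hp hc hxc).2 ⟨hzx, hz⟩))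
      have hinf : Subgroup.centralizer ({y} : Set G) ⊓ A = Subgroup.center G :=
        le_antisymm hle (le_inf (Subgroup.center_le_centralizer _)
          (Subgroup.center_le_centralizer _))
      have hbound := Subgroup.index_inf_le (H := Subgroup.centralizer ({y} : Set G)) (K := A)
      rw [hinf, hc, hi, hx, ← pow_two, Nat.pow_le_pow_iff_right hp.one_lt] at hbound
      omega
    have hconst : ∑ H ∈ T.erase A, F H = (T.erase A).card * (p - 1) := by
      rw [Finset.sum_const_nat]
      intro H hH
      obtain ⟨hne, hHT⟩ := Finset.mem_erase.1 hH
      have := hFp2 hHT ((hindex hHT).resolve_left (mt (huniq hHT) hne))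
      omega
    have hcard := Finset.card_erase_add_one hAT
    have hFA := hFp hAT hx
    rw [← Finset.sum_erase_add _ _ hAT, hconst] at hsum
    obtain ⟨r, rfl⟩ : ∃ r, p = r + 1 := ⟨p - 1, by omega⟩
    rw [Nat.add_sub_cancel] at hsum hp1
    have : (T.erase A).card = (r + 1) ^ 2 :=
      Nat.eq_of_mul_eq_mul_right hp1 (by linarith)
    omega
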